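/- arXiv:2310.12955 — 2 statements merged into one kernel-verified Lean document; each statement's English description precedes it below -/
import Mathlib

section
/- Robustness of IQL (Theorem 1). Fix β = 1 and fix V* : S → [0, R_max/(1−γ)]. Define the policies π_E(a|s) = π_μ(a|s)·exp([T V*](s,a) − V*(s)) / Z(s) and π̃_E(a|s) = π_D(a|s)·exp([T̃ V*](s,a) − V*(s)) / Z̃(s), where Z(s) and Z̃(s) are the normalizing constants making these probability mass functions on A. Assume (cumulative corruption): for each i = 1,…,N there exist ζ_i ≥ 0 and ζ'_i ≥ 1 such that for every V : S → [0, R_max/(1−γ)] and every a ∈ A one has |[T V](s_i,a) − [T̃ V](s_i,a)| ≤ ζ_i, and max(π_D(a|s_i)/π_μ(a|s_i), π_μ(a|s_i)/π_D(a|s_i)) ≤ ζ'_i; set ζ = Σ_{i=1}^N (2ζ_i + log ζ'_i). Assume (coverage): there exists M > 0 such that d^{π_E}(s,a) ≤ M·μ(s,a) and d^{π̃_E}(s,a) ≤ M·d_D(s,a) for all (s,a) ∈ S×A. Then for any initial distribution ρ0 on S and any policies π_IQL and π̃_IQL with π_IQL(a|s) > 0 and π̃_IQL(a|s) > 0 for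 all (s,a), it holds that V^{π_IQL}(ρ0) − V^{π̃_IQL}(ρ0) ≤ (√(2M)·R_max/(1−γ)²)·(√ε1 + √ε2) + (2R_max/(1−γ)²)·√(Mζ/N), where ε1 = Σ_s μ_S(s)·KL(π_E(·|s) ‖ π_IQL(·|s)) and ε2 = Σ_s d_D(s)·KL(π̃_E(·|s) ‖ π̃_IQL(·|s)). -/
/-- KL divergence between two probability mass functions on a finite set
(with the convention `0 · log 0 = 0`, which holds for `Real.log`). -/
noncomputable def KLdiv {α : Type*} [Fintype α] (p q : α → ℝ) : ℝ :=
  ∑ a, p a * Real.log (p a / q a)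

/-- The sharp pointwise inequality behind Pinsker's inequality. -/
theorem three_mul_sub_one_sq_le {x : ℝ} (hx : 0 < x) :
    3 * (x - 1) ^ 2 ≤ (2 * x + 4) * (x * Real.log x - x + 1) := by
  let f : ℝ → ℝ := fun y => Real.log y - (5 * y ^ 2 - 4 * y - 1) / (2 * y ^ 2 + 4 * y)
  have hderiv : ∀ y, 0 < y → HasDerivAt f ((y - 1) ^ 3 / (y ^ 2 * (y + 2) ^ 2)) y := by
    intro y hy
    have hne : 2 * y ^ 2 + 4 * y ≠ 0 := by positivity
    have hnum : HasDerivAt (fun y : ℝ => 5 * y ^ 2 - 4 * y - 1) (10 * y - 4) y := by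
      have h := (((hasDerivAt_pow 2 y).const_mul 5).sub
        ((hasDerivAt_id' y).const_mul 4)).sub_const 1
      exact h.congr_deriv (by norm_num; ring)
    have hden : HasDerivAt (fun y : ℝ => 2 * y ^ 2 + 4 * y) (4 * y + 4) y := by
      have h := ((hasDerivAt_pow 2 y).const_mul 2).add ((hasDerivAt_id' y).const_mul 4)
      exact h.congr_deriv (by norm_num; ring)
    refine ((Real.hasDerivAt_log hy.ne').sub (hnum.div hden hne)).congr_deriv ?_
    field_simp
    ring
  have hf1 : f 1 = 0 := by norm_num [f]
  have hf : 0 ≤ f x := by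
    rcases le_total x 1 with h | h
    · have hanti : AntitoneOn f (Set.Icc x 1) := by
        refine antitoneOn_of_hasDerivWithinAt_nonpos (convex_Icc _ _)
          (fun y hy => (hderiv y (hx.trans_le hy.1)).continuousAt.continuousWithinAt)
          (fun y hy => (hderiv y (hx.trans_le (interior_subset hy).1)).hasDerivWithinAt) ?_
        intro y hy
        have hy' := interior_subset hy
        exact div_nonpos_of_nonpos_of_nonneg
          (Odd.pow_nonpos (by decide) (by linarith [hy'.2])) (by positivity)
      rw [← hf1]
      exact hanti (Set.left_mem_Icc.2 h) (Set.right_mem_Icc.2 h) h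
    · have hmono : MonotoneOn f (Set.Icc 1 x) := by
        refine monotoneOn_of_hasDerivWithinAt_nonneg (convex_Icc _ _)
          (fun y hy => (hderiv y (one_pos.trans_le hy.1)).continuousAt.continuousWithinAt)
          (fun y hy => (hderiv y (one_pos.trans_le (interior_subset hy).1)).hasDerivWithinAt) ?_
        intro y hy
        have hy' : 0 ≤ y - 1 := sub_nonneg.2 (interior_subset hy).1
        positivity
      rw [← hf1]
      exact hmono (Set.left_mem_Icc.2 h) (Set.right_mem_Icc.2 h) h
  have hlog : (5 * x ^ 2 - 4 * x - 1) / (2 * x ^ 2 + 4 * x) ≤ Real.log x := sub_nonneg.1 hf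
  rw [div_le_iff₀ (by positivity)] at hlog
  nlinarith

/-- Pinsker's inequality on a finite set. -/
theorem sq_sum_abs_sub_le_two_mul_KLdiv {α : Type*} [Fintype α] {p q : α → ℝ}
    (hp : ∀ a, 0 < p a) (hq : ∀ a, 0 < q a) (hp_sum : ∑ a, p a = 1) (hq_sum : ∑ a, q a = 1) :
    (∑ a, |p a - q a|) ^ 2 ≤ 2 * KLdiv p q := by
  let w : α → ℝ := fun a => (2 * p a + 4 * q a) / 3
  let k : α → ℝ := fun a => p a * Real.log (p a / q a) - p a + q a
  have hw : ∀ a, 0 < w a := fun a => by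
    have := hp a
    have := hq a
    simp only [w]
    positivity
  have hwk : ∀ a, (p a - q a) ^ 2 ≤ w a * k a := by
    intro a
    have hqa := hq a
    have h := mul_le_mul_of_nonneg_left (three_mul_sub_one_sq_le (div_pos (hp a) hqa))
      (sq_nonneg (q a))
    have hl : q a ^ 2 * (3 * (p a / q a - 1) ^ 2) = 3 * (p a - q a) ^ 2 := by
      field_simp
    have hr : q a ^ 2 * ((2 * (p a / q a) + 4) *
        (p a / q a * Real.log (p a / q a) - p a / q a + 1)) = 3 * (w a * k a) := by
      simp only [w, k]
      generalize Real.log (p a / q a) = l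
      field_simp
    linarith
  have hk : ∀ a, 0 ≤ k a := fun a =>
    nonneg_of_mul_nonneg_right ((sq_nonneg _).trans (hwk a)) (hw a)
  have hcs := Finset.sum_sq_le_sum_mul_sum_of_sq_le_mul Finset.univ
    (fun a _ => (hw a).le) (fun a _ => hk a)
    (fun a _ => (sq_abs (p a - q a)).trans_le (hwk a))
  have hw_sum : ∑ a, w a = 2 := by
    simp only [w, ← Finset.sum_div, Finset.sum_add_distrib, ← Finset.mul_sum, hp_sum, hq_sum]
    norm_num
  have hk_sum : ∑ a, k a = KLdiv p q := by
    simp only [k, KLdiv, Finset.sum_add_distrib, Finset.sum_sub_distrib, hp_sum, hq_sum]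
    ring
  rwa [hw_sum, hk_sum] at hcs

theorem KLdiv_le_of_le_exp_mul {α : Type*} [Fintype α] {p q : α → ℝ} {C : ℝ}
    (hp : ∀ a, 0 < p a) (hq : ∀ a, 0 < q a) (hp_sum : ∑ a, p a = 1)
    (h : ∀ a, p a ≤ Real.exp C * q a) : KLdiv p q ≤ C := by
  calc KLdiv p q ≤ ∑ a, p a * C := by
        refine Finset.sum_le_sum fun a _ => mul_le_mul_of_nonneg_left ?_ (hp a).le
        rw [Real.log_le_iff_le_exp (div_pos (hp a) (hq a)), div_le_iff₀ (hq a)]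
        exact h a
    _ = C := by rw [← Finset.sum_mul, hp_sum, one_mul]

/-- Two exponentially tilted distributions with comparable base measures and close exponents are
close in KL divergence. -/
theorem KLdiv_tilted_le {α : Type*} [Fintype α] [Nonempty α] {p q f g : α → ℝ} {c z : ℝ}
    (hp : ∀ a, 0 < p a) (hq : ∀ a, 0 < q a) (hc : 0 < c)
    (hpq : ∀ a, p a ≤ c * q a) (hqp : ∀ a, q a ≤ c * p a) (hfg : ∀ a, |f a - g a| ≤ z) :
    KLdiv (fun a => p a * Real.exp (f a) / ∑ b, p b * Real.exp (f b))
      (fun a => q a * Real.exp (g a) / ∑ b, q b * Real.exp (g b)) ≤ 2 * z + 2 * Real.log c := by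
  have tilt_le : ∀ {p q f g : α → ℝ}, (∀ a, 0 < q a) → (∀ a, p a ≤ c * q a) →
      (∀ a, f a ≤ g a + z) →
      ∀ a, p a * Real.exp (f a) ≤ (c * Real.exp z) * (q a * Real.exp (g a)) := by
    intro p q f g hq hpq hfg a
    calc p a * Real.exp (f a) ≤ (c * q a) * Real.exp (g a + z) :=
          mul_le_mul (hpq a) (Real.exp_le_exp.2 (hfg a)) (Real.exp_pos _).le
            (mul_pos hc (hq a)).le
      _ = _ := by rw [Real.exp_add]; ring
  have hfg' := tilt_le hq hpq (f := f) (g := g) fun a => by linarith [(abs_le.1 (hfg a)).2]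
  have hgf' := tilt_le hp hqp (f := g) (g := f) fun a => by linarith [(abs_le.1 (hfg a)).1]
  have hZp : 0 < ∑ b, p b * Real.exp (f b) :=
    Finset.sum_pos (fun b _ => mul_pos (hp b) (Real.exp_pos _)) Finset.univ_nonempty
  have hZq : 0 < ∑ b, q b * Real.exp (g b) :=
    Finset.sum_pos (fun b _ => mul_pos (hq b) (Real.exp_pos _)) Finset.univ_nonempty
  have hZ : ∑ b, q b * Real.exp (g b) ≤ (c * Real.exp z) * ∑ b, p b * Real.exp (f b) := by
    rw [Finset.mul_sum]
    exact Finset.sum_le_sum fun b _ => hgf' b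
  refine KLdiv_le_of_le_exp_mul (fun a => div_pos (mul_pos (hp a) (Real.exp_pos _)) hZp)
    (fun a => div_pos (mul_pos (hq a) (Real.exp_pos _)) hZq)
    (by rw [← Finset.sum_div, div_self hZp.ne']) fun a => ?_
  have hexp : Real.exp (2 * z + 2 * Real.log c) = (c * Real.exp z) ^ 2 := by
    rw [← mul_add, two_mul, Real.exp_add, Real.exp_add, Real.exp_log hc]
    ring
  rw [hexp, ← mul_div_assoc, div_le_div_iff₀ hZp hZq]
  calc p a * Real.exp (f a) * ∑ b, q b * Real.exp (g b)
      ≤ ((c * Real.exp z) * (q a * Real.exp (g a))) *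
        ((c * Real.exp z) * ∑ b, p b * Real.exp (f b)) :=
        mul_le_mul (hfg' a) hZ hZq.le
          (mul_pos (mul_pos hc (Real.exp_pos _)) (mul_pos (hq a) (Real.exp_pos _))).le
    _ = _ := by ring

theorem abs_sum_mul_le {α : Type*} [Fintype α] {p f : α → ℝ} {B : ℝ}
    (hp : ∀ a, 0 ≤ p a) (hp_sum : ∑ a, p a = 1) (hf : ∀ a, |f a| ≤ B) :
    |∑ a, p a * f a| ≤ B := by
  calc |∑ a, p a * f a| ≤ ∑ a, |p a * f a| := Finset.abs_sum_le_sum_abs _ _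
    _ ≤ ∑ a, p a * B := by
        refine Finset.sum_le_sum fun a _ => ?_
        rw [abs_mul, abs_of_nonneg (hp a)]
        exact mul_le_mul_of_nonneg_left (hf a) (hp a)
    _ = B := by rw [← Finset.sum_mul, hp_sum, one_mul]

section MDP

variable {S A : Type*} [Fintype S] [Fintype A] {P : S → A → S → ℝ} {r : S → A → ℝ} {γ R : ℝ}

omit [Fintype A] in
theorem abs_backup_le (hP : ∀ s a s', 0 ≤ P s a s') (hP_sum : ∀ s a, ∑ s', P s a s' = 1)
    (hr : ∀ s a, |r s a| ≤ R) (hγ0 : 0 ≤ γ) {V : S → ℝ} {B : ℝ} (hV : ∀ s, |V s| ≤ B)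
    (s : S) (a : A) : |r s a + γ * ∑ s', P s a s' * V s'| ≤ R + γ * B := by
  refine (abs_add_le _ _).trans (add_le_add (hr s a) ?_)
  rw [abs_mul, abs_of_nonneg hγ0]
  exact mul_le_mul_of_nonneg_left (abs_sum_mul_le (hP s a) (hP_sum s a) hV) hγ0

theorem abs_value_le [Nonempty S] (hP : ∀ s a s', 0 ≤ P s a s')
    (hP_sum : ∀ s a, ∑ s', P s a s' = 1)
    (hr : ∀ s a, |r s a| ≤ R) (hγ0 : 0 ≤ γ) (hγ1 : γ < 1) {π : S → A → ℝ}
    (hπ : ∀ s a, 0 ≤ π s a) (hπ_sum : ∀ s, ∑ a, π s a = 1) {V : S → ℝ}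
    (hV : ∀ s, V s = ∑ a, π s a * (r s a + γ * ∑ s', P s a s' * V s')) (s : S) :
    |V s| ≤ R / (1 - γ) := by
  obtain ⟨t, ht⟩ := Finite.exists_max fun s => |V s|
  have h : |V t| ≤ R + γ * |V t| := by
    conv_lhs => rw [hV t]
    exact abs_sum_mul_le (hπ t) (hπ_sum t) (abs_backup_le hP hP_sum hr hγ0 ht t)
  refine (ht s).trans ?_
  rw [le_div_iff₀ (sub_pos.2 hγ1)]
  linarith

theorem exists_value [Nonempty S] (r : S → A → ℝ) (hP : ∀ s a s', 0 ≤ P s a s')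
    (hP_sum : ∀ s a, ∑ s', P s a s' = 1) (hγ0 : 0 ≤ γ) (hγ1 : γ < 1) {π : S → A → ℝ}
    (hπ : ∀ s a, 0 ≤ π s a) (hπ_sum : ∀ s, ∑ a, π s a = 1) :
    ∃ V : S → ℝ, ∀ s, V s = ∑ a, π s a * (r s a + γ * ∑ s', P s a s' * V s') := by
  let L : (S → ℝ) →ₗ[ℝ] (S → ℝ) :=
    { toFun := fun V s => V s - ∑ a, π s a * (γ * ∑ s', P s a s' * V s')
      map_add' := by
        intro V W
        ext s
        simp only [Pi.add_apply, mul_add, Finset.sum_add_distrib]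
        ring
      map_smul' := by
        intro c V
        ext s
        simp only [Pi.smul_apply, smul_eq_mul, RingHom.id_apply, mul_sub, Finset.mul_sum]
        congr 1
        refine Finset.sum_congr rfl fun a _ => Finset.sum_congr rfl fun s' _ => ?_
        ring }
  have hL : Function.Injective L := by
    rw [← LinearMap.ker_eq_bot, LinearMap.ker_eq_bot']
    intro V hV
    ext s
    have hfix : ∀ s, V s = ∑ a, π s a * ((0 : S → A → ℝ) s a + γ * ∑ s', P s a s' * V s') := by
      intro s
      simpa using sub_eq_zero.1 (congrFun hV s)
    have h := abs_value_le (R := 0) hP hP_sum (by simp) hγ0 hγ1 hπ hπ_sum hfix s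
    simpa using h
  obtain ⟨V, hV⟩ := LinearMap.injective_iff_surjective.1 hL fun s => ∑ a, π s a * r s a
  refine ⟨V, fun s => ?_⟩
  have h : V s - ∑ a, π s a * (γ * ∑ s', P s a s' * V s') = ∑ a, π s a * r s a := congrFun hV s
  simp only [mul_add, Finset.sum_add_distrib]
  linarith

variable {ρ d : S → ℝ} {π : S → A → ℝ}

theorem sum_occupancy_mul
    (hd : ∀ s', d s' = (1 - γ) * ρ s' + γ * ∑ s, ∑ a, d s * π s a * P s a s') (f : S → ℝ) :
    ∑ s, d s * f s = (1 - γ) * ∑ s, ρ s * f s +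
      γ * ∑ s, d s * ∑ a, π s a * ∑ s', P s a s' * f s' := by
  have hswap : ∑ s', (∑ s, ∑ a, d s * π s a * P s a s') * f s' =
      ∑ s, d s * ∑ a, π s a * ∑ s', P s a s' * f s' := by
    simp only [Finset.sum_mul, Finset.mul_sum]
    rw [Finset.sum_comm]
    refine Finset.sum_congr rfl fun s _ => ?_
    rw [Finset.sum_comm]
    refine Finset.sum_congr rfl fun a _ => Finset.sum_congr rfl fun s' _ => ?_
    ring
  rw [← hswap, Finset.mul_sum, Finset.mul_sum, ← Finset.sum_add_distrib]
  refine Finset.sum_congr rfl fun s _ => ?_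
  conv_lhs => rw [hd s]
  ring

theorem sum_occupancy (hP_sum : ∀ s a, ∑ s', P s a s' = 1) (hγ1 : γ < 1)
    (hπ_sum : ∀ s, ∑ a, π s a = 1) (hρ_sum : ∑ s, ρ s = 1)
    (hd : ∀ s', d s' = (1 - γ) * ρ s' + γ * ∑ s, ∑ a, d s * π s a * P s a s') :
    ∑ s, d s = 1 := by
  have h := sum_occupancy_mul hd fun _ => 1
  simp only [mul_one, hP_sum, hπ_sum, hρ_sum] at h
  have h' : (1 - γ) * (∑ s, d s - 1) = 0 := by linarith
  rcases mul_eq_zero.1 h' with h | h <;> linarith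

theorem occupancy_nonneg (hP : ∀ s a s', 0 ≤ P s a s') (hP_sum : ∀ s a, ∑ s', P s a s' = 1)
    (hγ0 : 0 ≤ γ) (hγ1 : γ < 1)
    (hπ : ∀ s a, 0 ≤ π s a) (hπ_sum : ∀ s, ∑ a, π s a = 1) (hρ : ∀ s, 0 ≤ ρ s)
    (hρ_sum : ∑ s, ρ s = 1)
    (hd : ∀ s', d s' = (1 - γ) * ρ s' + γ * ∑ s, ∑ a, d s * π s a * P s a s') (s : S) :
    0 ≤ d s := by
  have habs : ∀ s', |d s'| ≤ (1 - γ) * ρ s' + γ * ∑ s, ∑ a, |d s| * π s a * P s a s' := by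
    intro s'
    have hle : |∑ s, ∑ a, d s * π s a * P s a s'| ≤ ∑ s, ∑ a, |d s| * π s a * P s a s' := by
      refine (Finset.abs_sum_le_sum_abs _ _).trans (Finset.sum_le_sum fun s _ => ?_)
      refine (Finset.abs_sum_le_sum_abs _ _).trans (Finset.sum_le_sum fun a _ => ?_)
      rw [abs_mul, abs_mul, abs_of_nonneg (hπ s a), abs_of_nonneg (hP s a s')]
    conv_lhs => rw [hd s']
    refine (abs_add_le _ _).trans (add_le_add ?_ ?_)
    · rw [abs_of_nonneg (mul_nonneg (sub_pos.2 hγ1).le (hρ s'))]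
    · rw [abs_mul, abs_of_nonneg hγ0]
      exact mul_le_mul_of_nonneg_left hle hγ0
  have hswap : ∑ s', ∑ s, ∑ a, |d s| * π s a * P s a s' = ∑ s, |d s| := by
    rw [Finset.sum_comm]
    refine Finset.sum_congr rfl fun s _ => ?_
    rw [Finset.sum_comm]
    simp only [← Finset.mul_sum, hP_sum, hπ_sum, mul_one]
  have hsum := Finset.sum_le_sum fun s' (_ : s' ∈ Finset.univ) => habs s'
  rw [Finset.sum_add_distrib, ← Finset.mul_sum, ← Finset.mul_sum, hswap, hρ_sum] at hsum
  have habs_sum : ∑ s, |d s| ≤ 1 := by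
    by_contra! h
    nlinarith
  have hzero : ∑ s, (|d s| - d s) ≤ 0 := by
    rw [Finset.sum_sub_distrib, sum_occupancy hP_sum hγ1 hπ_sum hρ_sum hd]
    linarith
  have hs := (Finset.single_le_sum (f := fun s => |d s| - d s)
    (fun t _ => sub_nonneg.2 (le_abs_self (d t))) (Finset.mem_univ s)).trans hzero
  exact (abs_nonneg (d s)).trans (sub_nonpos.1 hs)

/-- The performance difference lemma. -/
theorem performance_difference
    (hd : ∀ s', d s' = (1 - γ) * ρ s' + γ * ∑ s, ∑ a, d s * π s a * P s a s')
    {π' : S → A → ℝ} {V V' : S → ℝ}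
    (hV : ∀ s, V s = ∑ a, π s a * (r s a + γ * ∑ s', P s a s' * V s'))
    (hV' : ∀ s, V' s = ∑ a, π' s a * (r s a + γ * ∑ s', P s a s' * V' s')) :
    (1 - γ) * (∑ s, ρ s * V s - ∑ s, ρ s * V' s) =
      ∑ s, d s * ∑ a, (π s a - π' s a) * (r s a + γ * ∑ s', P s a s' * V' s') := by
  have hdiff : ∀ s, V s - V' s =
      ∑ a, (π s a - π' s a) * (r s a + γ * ∑ s', P s a s' * V' s') +
        γ * ∑ a, π s a * ∑ s', P s a s' * (V s' - V' s') := by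
    intro s
    conv_lhs => rw [hV s, hV' s]
    rw [← Finset.sum_sub_distrib, Finset.mul_sum, ← Finset.sum_add_distrib]
    refine Finset.sum_congr rfl fun a _ => ?_
    simp only [mul_sub, Finset.sum_sub_distrib]
    ring
  have hflow := sum_occupancy_mul hd fun s => V s - V' s
  have hexpand : ∑ s, d s * (V s - V' s) =
      ∑ s, d s * ∑ a, (π s a - π' s a) * (r s a + γ * ∑ s', P s a s' * V' s') +
        γ * ∑ s, d s * ∑ a, π s a * ∑ s', P s a s' * (V s' - V' s') := by
    rw [Finset.mul_sum, ← Finset.sum_add_distrib]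
    refine Finset.sum_congr rfl fun s _ => ?_
    conv_lhs => rw [hdiff s]
    ring
  have hρ : ∑ s, ρ s * (V s - V' s) = ∑ s, ρ s * V s - ∑ s, ρ s * V' s := by
    simp only [mul_sub, Finset.sum_sub_distrib]
  rw [← hρ]
  linarith

/-- The returns of two policies are close when the policies are close in squared total variation,
on average over a distribution that covers the occupancy of one of them. -/
theorem abs_return_sub_le [Nonempty S] (hP : ∀ s a s', 0 ≤ P s a s')
    (hP_sum : ∀ s a, ∑ s', P s a s' = 1) (hR : 0 ≤ R) (hr : ∀ s a, |r s a| ≤ R)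
    (hγ0 : 0 ≤ γ) (hγ1 : γ < 1)
    (hπ : ∀ s a, 0 ≤ π s a) (hπ_sum : ∀ s, ∑ a, π s a = 1)
    (hρ : ∀ s, 0 ≤ ρ s) (hρ_sum : ∑ s, ρ s = 1)
    (hd : ∀ s', d s' = (1 - γ) * ρ s' + γ * ∑ s, ∑ a, d s * π s a * P s a s')
    {ν : S → A → ℝ} {M : ℝ} (hcov : ∀ s a, d s * π s a ≤ M * ν s a)
    {π' : S → A → ℝ} (hπ' : ∀ s a, 0 ≤ π' s a) (hπ'_sum : ∀ s, ∑ a, π' s a = 1)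
    {k : S → ℝ} (hk : ∀ s, (∑ a, |π s a - π' s a|) ^ 2 ≤ 2 * k s)
    {V V' : S → ℝ} (hV : ∀ s, V s = ∑ a, π s a * (r s a + γ * ∑ s', P s a s' * V s'))
    (hV' : ∀ s, V' s = ∑ a, π' s a * (r s a + γ * ∑ s', P s a s' * V' s')) :
    |∑ s, ρ s * V s - ∑ s, ρ s * V' s| ≤
      R / (1 - γ) ^ 2 * Real.sqrt (2 * M * ∑ s, (∑ a, ν s a) * k s) := by
  have hγ : 0 < 1 - γ := sub_pos.2 hγ1
  have hd0 := occupancy_nonneg hP hP_sum hγ0 hγ1 hπ hπ_sum hρ hρ_sum hd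
  have hd1 := sum_occupancy hP_sum hγ1 hπ_sum hρ_sum hd
  have hQ : ∀ s a, |r s a + γ * ∑ s', P s a s' * V' s'| ≤ R / (1 - γ) := fun s a => by
    convert abs_backup_le hP hP_sum hr hγ0
      (abs_value_le hP hP_sum hr hγ0 hγ1 hπ' hπ'_sum hV') s a using 1
    field_simp
    ring
  have hcov_state : ∀ s, d s ≤ M * ∑ a, ν s a := fun s => by
    calc d s = ∑ a, d s * π s a := by rw [← Finset.mul_sum, hπ_sum, mul_one]
      _ ≤ ∑ a, M * ν s a := Finset.sum_le_sum fun a _ => hcov s a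
      _ = _ := by rw [Finset.mul_sum]
  have htv : ∑ s, d s * ∑ a, |π s a - π' s a| ≤
      Real.sqrt (2 * M * ∑ s, (∑ a, ν s a) * k s) := by
    refine Real.le_sqrt_of_sq_le ?_
    have hcs := Finset.sum_sq_le_sum_mul_sum_of_sq_le_mul Finset.univ
      (r := fun s => d s * ∑ a, |π s a - π' s a|)
      (f := d) (g := fun s => d s * (∑ a, |π s a - π' s a|) ^ 2)
      (fun s _ => hd0 s) (fun s _ => mul_nonneg (hd0 s) (sq_nonneg _))
      (fun s _ => le_of_eq (by ring))
    rw [hd1, one_mul] at hcs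
    refine hcs.trans ?_
    rw [Finset.mul_sum]
    refine Finset.sum_le_sum fun s _ => ?_
    have hk0 : 0 ≤ 2 * k s := (sq_nonneg _).trans (hk s)
    calc d s * (∑ a, |π s a - π' s a|) ^ 2 ≤ d s * (2 * k s) :=
          mul_le_mul_of_nonneg_left (hk s) (hd0 s)
      _ ≤ (M * ∑ a, ν s a) * (2 * k s) := mul_le_mul_of_nonneg_right (hcov_state s) hk0
      _ = _ := by ring
  have hmain : (1 - γ) * |∑ s, ρ s * V s - ∑ s, ρ s * V' s| ≤
      R / (1 - γ) * ∑ s, d s * ∑ a, |π s a - π' s a| := by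
    rw [← abs_of_pos hγ, ← abs_mul, abs_of_pos hγ, performance_difference hd hV hV',
      Finset.mul_sum]
    refine (Finset.abs_sum_le_sum_abs _ _).trans (Finset.sum_le_sum fun s _ => ?_)
    rw [abs_mul, abs_of_nonneg (hd0 s), mul_left_comm]
    refine mul_le_mul_of_nonneg_left ?_ (hd0 s)
    rw [Finset.mul_sum]
    refine (Finset.abs_sum_le_sum_abs _ _).trans (Finset.sum_le_sum fun a _ => ?_)
    rw [abs_mul, mul_comm]
    exact mul_le_mul_of_nonneg_right (hQ s a) (abs_nonneg _)
  have hfinal := hmain.trans (mul_le_mul_of_nonneg_left htv (div_nonneg hR hγ.le))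
  rw [mul_comm, ← le_div_iff₀ hγ] at hfinal
  refine hfinal.trans_eq ?_
  field_simp

end MDP

theorem sum_empirical_mul {S A : Type*} [Fintype S] [Fintype A] [DecidableEq S] [DecidableEq A]
    {N : ℕ} {sa : Fin N → S × A} {dD : S → A → ℝ}
    (hdD : ∀ s a, dD s a = (∑ i, if sa i = (s, a) then (1 : ℝ) else 0) / N) (f : S → ℝ) :
    ∑ s, (∑ a, dD s a) * f s = (∑ i, f (sa i).1) / N := by
  have hi : ∀ i, ∑ s, ∑ a, (if sa i = (s, a) then (1 : ℝ) else 0) * f s = f (sa i).1 := by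
    intro i
    rw [← Fintype.sum_prod_type' (fun s a => (if sa i = (s, a) then (1 : ℝ) else 0) * f s)]
    simp
  have hcount : ∑ i, f (sa i).1 =
      ∑ s, ∑ a, ∑ i, (if sa i = (s, a) then (1 : ℝ) else 0) * f s := by
    simp only [← hi]
    rw [Finset.sum_comm]
    refine Finset.sum_congr rfl fun s _ => ?_
    rw [Finset.sum_comm]
  simp only [hcount, hdD, Finset.sum_mul, div_mul_eq_mul_div, Finset.sum_div]

theorem conditional_pos {A : Type*} [Fintype A] [Nonempty A] {m p : A → ℝ} (hm : ∀ a, 0 < m a)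
    (hp : ∀ a, p a = m a / ∑ b, m b) (a : A) : 0 < p a :=
  hp a ▸ div_pos (hm a) (Finset.sum_pos (fun b _ => hm b) Finset.univ_nonempty)

theorem sum_conditional {A : Type*} [Fintype A] [Nonempty A] {m p : A → ℝ} (hm : ∀ a, 0 < m a)
    (hp : ∀ a, p a = m a / ∑ b, m b) : ∑ a, p a = 1 := by
  simp only [hp, ← Finset.sum_div]
  exact div_self (Finset.sum_pos (fun b _ => hm b) Finset.univ_nonempty).ne'

/-- Robustness of IQL (Theorem 1), with `β = 1`.  Under the cumulative corruption
assumption and the coverage conditions `d^{π_E}(s,a) ≤ M·μ(s,a)` and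
`d^{π̃_E}(s,a) ≤ M·d_D(s,a)`, for any positive policies `π_IQL` and `π̃_IQL`,
`V^{π_IQL}(ρ0) − V^{π̃_IQL}(ρ0) ≤ (√(2M)·R_max/(1−γ)²)·(√ε1 + √ε2)
  + (2R_max/(1−γ)²)·√(Mζ/N)`,
where `ε1 = Σ_s μ_S(s)·KL(π_E(·|s) ‖ π_IQL(·|s))` and
`ε2 = Σ_s d_D(s)·KL(π̃_E(·|s) ‖ π̃_IQL(·|s))`. -/
theorem robustness_of_IQL
    {S A : Type*} [Fintype S] [Fintype A] [Nonempty S] [Nonempty A]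
    [DecidableEq S] [DecidableEq A]
    -- true and corrupted transition kernels
    (P Pt : S → A → S → ℝ)
    (hP_nonneg : ∀ s a s', 0 ≤ P s a s')
    (hP_sum : ∀ s a, ∑ s', P s a s' = 1)
    (hPt_nonneg : ∀ s a s', 0 ≤ Pt s a s')
    (hPt_sum : ∀ s a, ∑ s', Pt s a s' = 1)
    -- true and corrupted rewards
    (r rt : S → A → ℝ) (Rmax : ℝ) (hRmax : 0 < Rmax)
    (hr : ∀ s a, |r s a| ≤ Rmax)
    (γ : ℝ) (hγ0 : 0 ≤ γ) (hγ1 : γ < 1)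
    -- fixed value function V*
    (Vstar : S → ℝ)
    (hVstar : ∀ s, 0 ≤ Vstar s ∧ Vstar s ≤ Rmax / (1 - γ))
    -- behavior distribution μ and its conditional policy π_μ
    (μ : S → A → ℝ) (hμ_pos : ∀ s a, 0 < μ s a) (hμ_sum : ∑ s, ∑ a, μ s a = 1)
    (πμ : S → A → ℝ) (hπμ : ∀ s a, πμ s a = μ s a / ∑ b, μ s b)
    -- dataset, empirical distribution d_D, and its conditional policy π_D
    (N : ℕ) (hN : 0 < N) (sa : Fin N → S × A)
    (dD : S → A → ℝ)
    (hdD : ∀ s a, dD s a = (∑ i, if sa i = (s, a) then (1 : ℝ) else 0) / N)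
    (hdD_pos : ∀ s a, 0 < dD s a)
    (πD : S → A → ℝ) (hπD : ∀ s a, πD s a = dD s a / ∑ b, dD s b)
    -- the tilted policies π_E and π̃_E (β = 1)
    (πE πtE : S → A → ℝ)
    (hπE : ∀ s a, πE s a =
      πμ s a * Real.exp ((r s a + γ * ∑ s', P s a s' * Vstar s') - Vstar s) /
        ∑ b, πμ s b * Real.exp ((r s b + γ * ∑ s', P s b s' * Vstar s') - Vstar s))
    (hπtE : ∀ s a, πtE s a =
      πD s a * Real.exp ((rt s a + γ * ∑ s', Pt s a s' * Vstar s') - Vstar s) /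
        ∑ b, πD s b * Real.exp ((rt s b + γ * ∑ s', Pt s b s' * Vstar s') - Vstar s))
    -- cumulative corruption assumption
    (ζ ζ' : Fin N → ℝ)
    (hζ_nonneg : ∀ i, 0 ≤ ζ i) (hζ'_ge_one : ∀ i, 1 ≤ ζ' i)
    (hcorrupt : ∀ V : S → ℝ, (∀ s, 0 ≤ V s ∧ V s ≤ Rmax / (1 - γ)) →
      ∀ i a, |(r (sa i).1 a + γ * ∑ s', P (sa i).1 a s' * V s') -
        (rt (sa i).1 a + γ * ∑ s', Pt (sa i).1 a s' * V s')| ≤ ζ i)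
    (hratio : ∀ i a, πD (sa i).1 a / πμ (sa i).1 a ≤ ζ' i ∧
      πμ (sa i).1 a / πD (sa i).1 a ≤ ζ' i)
    -- initial distribution and occupancies of π_E and π̃_E
    (ρ0 : S → ℝ) (hρ0_nonneg : ∀ s, 0 ≤ ρ0 s) (hρ0_sum : ∑ s, ρ0 s = 1)
    (dE : S → ℝ)
    (hdE : ∀ s', dE s' = (1 - γ) * ρ0 s' + γ * ∑ s, ∑ a, dE s * πE s a * P s a s')
    (dtE : S → ℝ)
    (hdtE : ∀ s', dtE s' = (1 - γ) * ρ0 s' + γ * ∑ s, ∑ a, dtE s * πtE s a * P s a s')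
    -- coverage assumption
    (M : ℝ) (hM : 0 < M)
    (hcov : ∀ s a, dE s * πE s a ≤ M * μ s a)
    (hcov' : ∀ s a, dtE s * πtE s a ≤ M * dD s a)
    -- the learned policies π_IQL and π̃_IQL (positive pmfs)
    (πIQL πtIQL : S → A → ℝ)
    (hπIQL_pos : ∀ s a, 0 < πIQL s a) (hπIQL_sum : ∀ s, ∑ a, πIQL s a = 1)
    (hπtIQL_pos : ∀ s a, 0 < πtIQL s a) (hπtIQL_sum : ∀ s, ∑ a, πtIQL s a = 1)
    -- value functions of π_IQL and π̃_IQL in the true MDP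
    (VIQL VtIQL : S → ℝ)
    (hVIQL : ∀ s, VIQL s = ∑ a, πIQL s a * (r s a + γ * ∑ s', P s a s' * VIQL s'))
    (hVtIQL : ∀ s, VtIQL s = ∑ a, πtIQL s a * (r s a + γ * ∑ s', P s a s' * VtIQL s')) :
    (∑ s, ρ0 s * VIQL s) - (∑ s, ρ0 s * VtIQL s) ≤
      Real.sqrt (2 * M) * Rmax / (1 - γ) ^ 2 *
        (Real.sqrt (∑ s, (∑ a, μ s a) * KLdiv (πE s) (πIQL s)) +
          Real.sqrt (∑ s, (∑ a, dD s a) * KLdiv (πtE s) (πtIQL s))) +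
      2 * Rmax / (1 - γ) ^ 2 *
        Real.sqrt (M * (∑ i, (2 * ζ i + Real.log (ζ' i))) / N) := by
  have hπμ_pos : ∀ s a, 0 < πμ s a := fun s => conditional_pos (hμ_pos s) (hπμ s)
  have hπD_pos : ∀ s a, 0 < πD s a := fun s => conditional_pos (hdD_pos s) (hπD s)
  have hπE_pos : ∀ s a, 0 < πE s a := fun s =>
    conditional_pos (fun a => mul_pos (hπμ_pos s a) (Real.exp_pos _)) (hπE s)
  have hπE_sum : ∀ s, ∑ a, πE s a = 1 := fun s =>
    sum_conditional (fun a => mul_pos (hπμ_pos s a) (Real.exp_pos _)) (hπE s)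
  have hπtE_pos : ∀ s a, 0 < πtE s a := fun s =>
    conditional_pos (fun a => mul_pos (hπD_pos s a) (Real.exp_pos _)) (hπtE s)
  have hπtE_sum : ∀ s, ∑ a, πtE s a = 1 := fun s =>
    sum_conditional (fun a => mul_pos (hπD_pos s a) (Real.exp_pos _)) (hπtE s)
  obtain ⟨VE, hVE⟩ := exists_value r hP_nonneg hP_sum hγ0 hγ1
    (fun s a => (hπE_pos s a).le) hπE_sum
  obtain ⟨VtE, hVtE⟩ := exists_value r hP_nonneg hP_sum hγ0 hγ1
    (fun s a => (hπtE_pos s a).le) hπtE_sum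
  have hclean := abs_return_sub_le hP_nonneg hP_sum hRmax.le hr hγ0 hγ1
    (fun s a => (hπE_pos s a).le) hπE_sum hρ0_nonneg hρ0_sum hdE hcov
    (fun s a => (hπIQL_pos s a).le) hπIQL_sum
    (fun s => sq_sum_abs_sub_le_two_mul_KLdiv (hπE_pos s) (hπIQL_pos s) (hπE_sum s)
      (hπIQL_sum s)) hVE hVIQL
  have hcorrupted := abs_return_sub_le hP_nonneg hP_sum hRmax.le hr hγ0 hγ1
    (fun s a => (hπtE_pos s a).le) hπtE_sum hρ0_nonneg hρ0_sum hdtE hcov'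
    (fun s a => (hπtIQL_pos s a).le) hπtIQL_sum
    (fun s => sq_sum_abs_sub_le_two_mul_KLdiv (hπtE_pos s) (hπtIQL_pos s) (hπtE_sum s)
      (hπtIQL_sum s)) hVtE hVtIQL
  have hexperts := abs_return_sub_le hP_nonneg hP_sum hRmax.le hr hγ0 hγ1
    (fun s a => (hπtE_pos s a).le) hπtE_sum hρ0_nonneg hρ0_sum hdtE hcov'
    (fun s a => (hπE_pos s a).le) hπE_sum
    (fun s => sq_sum_abs_sub_le_two_mul_KLdiv (hπtE_pos s) (hπE_pos s) (hπtE_sum s)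
      (hπE_sum s)) hVtE hVE
  have hKL : ∀ i, KLdiv (πtE (sa i).1) (πE (sa i).1) ≤ 2 * ζ i + 2 * Real.log (ζ' i) := by
    intro i
    rw [show πtE (sa i).1 = _ from funext (hπtE (sa i).1),
      show πE (sa i).1 = _ from funext (hπE (sa i).1)]
    refine KLdiv_tilted_le (hπD_pos _) (hπμ_pos _) (one_pos.trans_le (hζ'_ge_one i))
      (fun a => (div_le_iff₀ (hπμ_pos _ a)).1 (hratio i a).1)
      (fun a => (div_le_iff₀ (hπD_pos _ a)).1 (hratio i a).2) fun a => ?_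
    rw [sub_sub_sub_cancel_right, abs_sub_comm]
    exact hcorrupt Vstar hVstar i a
  have hKL_sum : ∑ s, (∑ a, dD s a) * KLdiv (πtE s) (πE s) ≤
      2 * ((∑ i, (2 * ζ i + Real.log (ζ' i))) / N) := by
    rw [sum_empirical_mul hdD, ← mul_div_assoc, Finset.mul_sum]
    refine div_le_div_of_nonneg_right (Finset.sum_le_sum fun i _ => ?_) (Nat.cast_nonneg N)
    linarith [hKL i, hζ_nonneg i]
  have hsqrt : Real.sqrt (2 * M * ∑ s, (∑ a, dD s a) * KLdiv (πtE s) (πE s)) ≤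
      2 * Real.sqrt (M * (∑ i, (2 * ζ i + Real.log (ζ' i))) / N) := by
    calc Real.sqrt (2 * M * ∑ s, (∑ a, dD s a) * KLdiv (πtE s) (πE s))
        ≤ Real.sqrt (2 ^ 2 * (M * (∑ i, (2 * ζ i + Real.log (ζ' i))) / N)) := by
          refine Real.sqrt_le_sqrt
            ((mul_le_mul_of_nonneg_left hKL_sum (by positivity)).trans_eq ?_)
          ring
      _ = _ := by rw [Real.sqrt_mul (by norm_num), Real.sqrt_sq (by norm_num)]
  have hC : 0 ≤ Rmax / (1 - γ) ^ 2 := by positivity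
  have hexperts' := hexperts.trans (mul_le_mul_of_nonneg_left hsqrt hC)
  rw [Real.sqrt_mul (by positivity)] at hclean hcorrupted
  calc (∑ s, ρ0 s * VIQL s) - (∑ s, ρ0 s * VtIQL s)
      ≤ Rmax / (1 - γ) ^ 2 *
          (Real.sqrt (2 * M) * Real.sqrt (∑ s, (∑ a, μ s a) * KLdiv (πE s) (πIQL s))) +
        Rmax / (1 - γ) ^ 2 *
          (Real.sqrt (2 * M) * Real.sqrt (∑ s, (∑ a, dD s a) * KLdiv (πtE s) (πtIQL s))) +
        Rmax / (1 - γ) ^ 2 *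
          (2 * Real.sqrt (M * (∑ i, (2 * ζ i + Real.log (ζ' i))) / N)) := by
        linarith [(abs_le.1 hclean).1, (abs_le.1 hcorrupted).2, (abs_le.1 hexperts').1]
    _ = _ := by ring
end

section
/- Value difference via total variation of policies (equation (111) in the proof of Theorem 1). Let π and π' be two policies. Then for any initial probability мass function ρ0 on S, V^{π}(ρ0) − V^{π'}(ρ0) ≤ (R_max/(1−γ)²)·Σ_{s∈S} d^{π'}(s)·Σ_{a∈A} |π(a|s) − π'(a|s)|, where d^{π'} is the discounted state occupancy of π' with respect to ρ0. -/
/-- An average of reals bounded by `c` in absolute value is bounded by `c`. -/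
theorem abs_sum_mul_le_of_sum_eq_one {ι : Type*} [Fintype ι] {w f : ι → ℝ} {c : ℝ}
    (hw : ∀ i, 0 ≤ w i) (hw1 : ∑ i, w i = 1) (hf : ∀ i, |f i| ≤ c) :
    |∑ i, w i * f i| ≤ c := by
  calc |∑ i, w i * f i| ≤ ∑ i, |w i * f i| := Finset.abs_sum_le_sum_abs _ _
    _ ≤ ∑ i, w i * c := Finset.sum_le_sum fun i _ => by
        rw [abs_mul, abs_of_nonneg (hw i)]
        exact mul_le_mul_of_nonneg_left (hf i) (hw i)
    _ = c := by rw [← Finset.sum_mul, hw1, one_mul]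

/-- One Bellman backup of a function bounded by `M` is bounded by `R + γ * M`. -/
theorem abs_add_discounted_average_le {S : Type*} [Fintype S] {p V : S → ℝ} {x R M γ : ℝ}
    (hp : ∀ s, 0 ≤ p s) (hp1 : ∑ s, p s = 1) (hx : |x| ≤ R) (hγ : 0 ≤ γ)
    (hV : ∀ s, |V s| ≤ M) :
    |x + γ * ∑ s, p s * V s| ≤ R + γ * M := by
  refine (abs_add_le _ _).trans (add_le_add hx ?_)
  rw [abs_mul, abs_of_nonneg hγ]
  exact mul_le_mul_of_nonneg_left (abs_sum_mul_le_of_sum_eq_one hp hp1 hV) hγ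

/-- A solution of the Bellman equation is bounded by `R / (1 - γ)`. -/
theorem abs_le_of_bellman {S A : Type*} [Fintype S] [Fintype A]
    {P : S → A → S → ℝ} (hP : ∀ s a s', 0 ≤ P s a s') (hP1 : ∀ s a, ∑ s', P s a s' = 1)
    {r : S → A → ℝ} {R : ℝ} (hr : ∀ s a, |r s a| ≤ R) {γ : ℝ} (hγ0 : 0 ≤ γ) (hγ1 : γ < 1)
    {π : S → A → ℝ} (hπ : ∀ s a, 0 ≤ π s a) (hπ1 : ∀ s, ∑ a, π s a = 1) {V : S → ℝ}
    (hV : ∀ s, V s = ∑ a, π s a * (r s a + γ * ∑ s', P s a s' * V s')) (s : S) :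
    |V s| ≤ R / (1 - γ) := by
  have : Nonempty S := ⟨s⟩
  obtain ⟨m, hm⟩ := Finite.exists_max fun s => |V s|
  have h : |V m| ≤ R + γ * |V m| := by
    conv_lhs => rw [hV m]
    exact abs_sum_mul_le_of_sum_eq_one (hπ m) (hπ1 m) fun a =>
      abs_add_discounted_average_le (hP m a) (hP1 m a) (hr m a) hγ0 hm
  rw [le_div_iff₀ (by linarith)]
  nlinarith [hm s]

/-- A solution of the discounted flow equation with nonnegative source is nonnegative. -/
theorem nonneg_of_discounted_flow {S : Type*} [Fintype S] {K : S → S → ℝ}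
    (hK : ∀ s s', 0 ≤ K s s') (hK1 : ∀ s, ∑ s', K s s' = 1) {γ : ℝ} (hγ0 : 0 ≤ γ)
    (hγ1 : γ < 1) {b d : S → ℝ} (hb : ∀ s, 0 ≤ b s)
    (hd : ∀ s', d s' = b s' + γ * ∑ s, d s * K s s') (s : S) : 0 ≤ d s := by
  have hle : ∀ s', (d s')⁻ ≤ γ * ∑ s, (d s)⁻ * K s s' := fun s' => by
    have h1 : -∑ s, d s * K s s' ≤ ∑ s, (d s)⁻ * K s s' := by
      rw [← Finset.sum_neg_distrib]
      refine Finset.sum_le_sum fun s _ => ?_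
      rw [← neg_mul]
      exact mul_le_mul_of_nonneg_right (neg_le_negPart _) (hK s s')
    have h0 : 0 ≤ ∑ s, (d s)⁻ * K s s' :=
      Finset.sum_nonneg fun s _ => mul_nonneg (negPart_nonneg _) (hK s s')
    refine sup_le ?_ (mul_nonneg hγ0 h0)
    rw [hd s']
    nlinarith [hb s', mul_le_mul_of_nonneg_left h1 hγ0]
  have hsum : ∑ s', (d s')⁻ ≤ γ * ∑ s, (d s)⁻ := by
    calc ∑ s', (d s')⁻ ≤ ∑ s', γ * ∑ s, (d s)⁻ * K s s' := Finset.sum_le_sum fun s' _ => hle s'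
      _ = γ * ∑ s, (d s)⁻ := by
        rw [← Finset.mul_sum, Finset.sum_comm]
        simp_rw [← Finset.mul_sum, hK1, mul_one]
  have h1 : (d s)⁻ ≤ ∑ s, (d s)⁻ :=
    Finset.single_le_sum (f := fun s => (d s)⁻) (fun _ _ => negPart_nonneg _) (Finset.mem_univ s)
  have h2 : (d s)⁻ ≤ 0 := by nlinarith
  linarith [neg_le_negPart (d s)]

/-- Pairing a discounted flow with `W - γ K W` recovers the pairing of `W` with the source. -/
theorem sum_flow_mul_sub_discounted {S : Type*} [Fintype S] {K : S → S → ℝ} {γ : ℝ}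
    {b d : S → ℝ} (hd : ∀ s', d s' = b s' + γ * ∑ s, d s * K s s') (W : S → ℝ) :
    ∑ s, d s * (W s - γ * ∑ s', K s s' * W s') = ∑ s, b s * W s := by
  have h1 : ∑ s, d s * W s = ∑ s, b s * W s + γ * ∑ s, d s * ∑ s', K s s' * W s' := by
    calc ∑ s, d s * W s = ∑ s', (b s' * W s' + γ * ∑ s, d s * (K s s' * W s')) :=
          Finset.sum_congr rfl fun s' _ => by
            conv_lhs => rw [hd s']
            rw [add_mul, mul_assoc, Finset.sum_mul]
            simp_rw [mul_assoc]
      _ = _ := by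
        rw [Finset.sum_add_distrib, ← Finset.mul_sum, Finset.sum_comm]
        simp_rw [Finset.mul_sum]
  have h2 : ∑ s, d s * (W s - γ * ∑ s', K s s' * W s')
      = ∑ s, d s * W s - γ * ∑ s, d s * ∑ s', K s s' * W s' := by
    rw [Finset.mul_sum, ← Finset.sum_sub_distrib]
    exact Finset.sum_congr rfl fun s _ => by ring
  linarith

/-- Value difference via total variation of policies (equation (111)):
`V^π(ρ0) − V^{π'}(ρ0) ≤ (R_max/(1−γ)²) · Σ_s d^{π'}(s) · Σ_a |π(a|s) − π'(a|s)|`. -/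
theorem value_difference_via_total_variation
    {S A : Type*} [Fintype S] [Fintype A] [Nonempty S] [Nonempty A]
    (P : S → A → S → ℝ)
    (hP_nonneg : ∀ s a s', 0 ≤ P s a s')
    (hP_sum : ∀ s a, ∑ s', P s a s' = 1)
    (r : S → A → ℝ) (Rmax : ℝ) (hRmax : 0 < Rmax)
    (hr : ∀ s a, |r s a| ≤ Rmax)
    (γ : ℝ) (hγ0 : 0 ≤ γ) (hγ1 : γ < 1)
    (π π' : S → A → ℝ)
    (hπ_nonneg : ∀ s a, 0 ≤ π s a) (hπ_sum : ∀ s, ∑ a, π s a = 1)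
    (hπ'_nonneg : ∀ s a, 0 ≤ π' s a) (hπ'_sum : ∀ s, ∑ a, π' s a = 1)
    (Vπ Vπ' : S → ℝ)
    (hV : ∀ s, Vπ s = ∑ a, π s a * (r s a + γ * ∑ s', P s a s' * Vπ s'))
    (hV' : ∀ s, Vπ' s = ∑ a, π' s a * (r s a + γ * ∑ s', P s a s' * Vπ' s'))
    (ρ0 : S → ℝ) (hρ0_nonneg : ∀ s, 0 ≤ ρ0 s) (hρ0_sum : ∑ s, ρ0 s = 1)
    (dπ' : S → ℝ)
    (hd' : ∀ s', dπ' s' = (1 - γ) * ρ0 s' + γ * ∑ s, ∑ a, dπ' s * π' s a * P s a s') :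
    (∑ s, ρ0 s * Vπ s) - (∑ s, ρ0 s * Vπ' s) ≤
      (Rmax / (1 - γ) ^ 2) * ∑ s, dπ' s * ∑ a, |π s a - π' s a| := by
  have hg : 0 < 1 - γ := by linarith
  let K : S → S → ℝ := fun s s' => ∑ a, π' s a * P s a s'
  have hK : ∀ s s', 0 ≤ K s s' := fun s s' =>
    Finset.sum_nonneg fun a _ => mul_nonneg (hπ'_nonneg s a) (hP_nonneg s a s')
  have hK1 : ∀ s, ∑ s', K s s' = 1 := fun s => by
    simp only [K]
    rw [Finset.sum_comm]
    simp_rw [← Finset.mul_sum, hP_sum, mul_one, hπ'_sum]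
  have hd : ∀ s', dπ' s' = (1 - γ) * ρ0 s' + γ * ∑ s, dπ' s * K s s' := fun s' => by
    simp only [K, Finset.mul_sum, ← mul_assoc]
    simpa only [Finset.mul_sum, ← mul_assoc] using hd' s'
  have hd0 := nonneg_of_discounted_flow hK hK1 hγ0 hγ1
    (fun s => mul_nonneg hg.le (hρ0_nonneg s)) hd
  let Q : S → A → ℝ := fun s a => r s a + γ * ∑ s', P s a s' * Vπ s'
  have hQ : ∀ s a, |Q s a| ≤ Rmax / (1 - γ) := fun s a => by
    refine (abs_add_discounted_average_le (hP_nonneg s a) (hP_sum s a) (hr s a) hγ0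
      (abs_le_of_bellman hP_nonneg hP_sum hr hγ0 hγ1 hπ_nonneg hπ_sum hV)).trans_eq ?_
    field_simp
    ring
  have hadv : ∀ s, (Vπ s - Vπ' s) - γ * ∑ s', K s s' * (Vπ s' - Vπ' s')
      = ∑ a, (π s a - π' s a) * Q s a := fun s => by
    have hKW : ∑ s', K s s' * (Vπ s' - Vπ' s')
        = ∑ a, π' s a * (∑ s', P s a s' * Vπ s' - ∑ s', P s a s' * Vπ' s') := by
      simp only [K, Finset.sum_mul]
      rw [Finset.sum_comm]
      simp_rw [← Finset.sum_sub_distrib, Finset.mul_sum]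
      exact Finset.sum_congr rfl fun a _ => Finset.sum_congr rfl fun s' _ => by ring
    rw [hKW, hV s, hV' s, Finset.mul_sum, ← Finset.sum_sub_distrib, ← Finset.sum_sub_distrib]
    exact Finset.sum_congr rfl fun a _ => by simp only [Q]; ring
  have hpair := sum_flow_mul_sub_discounted hd fun s => Vπ s - Vπ' s
  simp only [hadv] at hpair
  have hbound : ∑ s, dπ' s * ∑ a, (π s a - π' s a) * Q s a
      ≤ Rmax / (1 - γ) * ∑ s, dπ' s * ∑ a, |π s a - π' s a| := by
    rw [Finset.mul_sum]
    refine Finset.sum_le_sum fun s _ => ?_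
    rw [mul_left_comm, Finset.mul_sum _ _ (Rmax / (1 - γ))]
    refine mul_le_mul_of_nonneg_left (Finset.sum_le_sum fun a _ => ?_) (hd0 s)
    rw [mul_comm (Rmax / (1 - γ))]
    refine (le_abs_self _).trans ?_
    rw [abs_mul]
    exact mul_le_mul_of_nonneg_left (hQ s a) (abs_nonneg _)
  have hρ : ∑ s, (1 - γ) * ρ0 s * (Vπ s - Vπ' s)
      = (1 - γ) * ((∑ s, ρ0 s * Vπ s) - ∑ s, ρ0 s * Vπ' s) := by
    rw [← Finset.sum_sub_distrib, Finset.mul_sum]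
    exact Finset.sum_congr rfl fun s _ => by ring
  rw [hpair, hρ] at hbound
  refine le_of_mul_le_mul_left (hbound.trans_eq ?_) hg
  field_simp
end
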